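/- arXiv:1804.10561 — 6 statements merged into one kernel-verified Lean document; each statement's English description precedes it below -/
import Mathlib

section
/- Let p be a polynomial with integer coefficients of degree at least 2. Then the graph set S = {(n, p(n)) : n ∈ ℤ}, viewed as a subset of the additive group ℤ × ℤ, is infinite, but S is NOT equal to any finite union of cosets of subgroups of ℤ × ℤ. (This is the paper's Example 1.1, showing that the Mordell–Lang conclusion fails for the algebraic group 𝔾ₐ²: the graph of p meets the finitely generated subgroup ℤ × ℤ in a Zariski dense set that is not a finite union of cosets.) -/
open Polynomial in
/-- An integer polynomial of degree at least two is not affine along any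
nonconstant arithmetic progression. -/
theorem eq_zero_of_eval_add_mul_eq {p : ℤ[X]} (hdeg : 2 ≤ p.natDegree) {m a c b : ℤ}
    (h : ∀ t : ℤ, p.eval (m + t * a) = c + t * b) : a = 0 := by
  by_contra ha
  have hcomp : p.comp (C a * X + C m) = C b * X + C c := by
    refine Polynomial.funext fun t => ?_
    have ht := h t
    simp only [eval_comp, eval_add, eval_mul, eval_C, eval_X]
    rw [show a * t + m = m + t * a by ring, ht]
    ring
  have hnat := congrArg natDegree hcomp
  rw [natDegree_comp, natDegree_linear ha, mul_one] at hnat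
  have hle : (C b * X + C c).natDegree ≤ 1 := natDegree_linear_le
  omega

/-- A coset contained in the graph of an integer polynomial of degree at least two
is a coset of the trivial subgroup. -/
theorem addSubgroup_eq_bot_of_coset_subset_graph {p : Polynomial ℤ} (hdeg : 2 ≤ p.natDegree)
    {g : ℤ × ℤ} {H : AddSubgroup (ℤ × ℤ)}
    (hsub : ∀ x ∈ H, (g + x).2 = p.eval (g + x).1) : H = ⊥ := by
  rw [AddSubgroup.eq_bot_iff_forall]
  rintro ⟨a, b⟩ hx
  have hline : ∀ t : ℤ, p.eval (g.1 + t * a) = g.2 + t * b := fun t => by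
    simpa using (hsub _ (H.zsmul_mem hx t)).symm
  obtain rfl : a = 0 := eq_zero_of_eval_add_mul_eq hdeg hline
  have h0 := hline 0
  have h1 := hline 1
  simp only [mul_zero, add_zero, zero_mul, one_mul] at h0 h1
  ext <;> simp
  linarith

/-- Example 1.1: the graph of an integer polynomial of degree ≥ 2 is an infinite
subset of ℤ × ℤ which is not a finite union of cosets of subgroups of ℤ × ℤ. -/
theorem graph_of_polynomial_not_finite_union_of_cosets
    (p : Polynomial ℤ) (hdeg : 2 ≤ p.natDegree)
    (S : Set (ℤ × ℤ)) (hS : S = {q : ℤ × ℤ | ∃ n : ℤ, q = (n, p.eval n)}) :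
    S.Infinite ∧
      ¬ ∃ (k : ℕ) (g : Fin k → ℤ × ℤ) (H : Fin k → AddSubgroup (ℤ × ℤ)),
        S = ⋃ i : Fin k, (fun x => g i + x) '' (H i : Set (ℤ × ℤ)) := by
  subst hS
  have hinf : {q : ℤ × ℤ | ∃ n : ℤ, q = (n, p.eval n)}.Infinite := by
    refine (Set.infinite_range_of_injective (f := fun n : ℤ => (n, p.eval n))
      fun m n hmn => congrArg Prod.fst hmn).mono ?_
    rintro _ ⟨n, rfl⟩
    exact ⟨n, rfl⟩
  refine ⟨hinf, ?_⟩
  rintro ⟨k, g, H, hU⟩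
  refine hinf ?_
  rw [hU]
  refine Set.finite_iUnion fun i => ?_
  have hbot : H i = ⊥ := by
    refine addSubgroup_eq_bot_of_coset_subset_graph hdeg (g := g i) fun x hx => ?_
    have hmem : g i + x ∈ {q : ℤ × ℤ | ∃ n : ℤ, q = (n, p.eval n)} := by
      rw [hU]
      exact Set.mem_iUnion.2 ⟨i, x, hx, rfl⟩
    obtain ⟨n, hn⟩ := hmem
    rw [hn]
  simp [hbot]
end

section
/- Let d be a positive integer that is not a perfect square. Then the solution set S = {(x, y) ∈ ℤ × ℤ : x² − d·y² = 1} of Pell's equation is infinite, but S is NOT equal to any finite union of cosets of subgroups of the additive group ℤ × ℤ. -/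
/-- The anisotropy of the form `x² - d y²` over `ℤ` when `d` is not a square. -/
theorem eq_zero_of_sq_sub_mul_sq_eq_zero {d : ℤ} (hsq : ¬ ∃ e : ℤ, d = e ^ 2) {a b : ℤ}
    (h : a ^ 2 - d * b ^ 2 = 0) : a = 0 ∧ b = 0 := by
  by_cases hb : b = 0
  · subst hb
    simpa using h
  · exfalso
    have hdvd : b ∣ a := (Int.pow_dvd_pow_iff two_ne_zero).mp ⟨d, by linarith⟩
    obtain ⟨c, rfl⟩ := hdvd
    refine hsq ⟨c, mul_right_cancel₀ (pow_ne_zero 2 hb) ?_⟩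
    linarith

theorem pell_solutions_infinite {d : ℤ} (hd : 0 < d) (hsq : ¬ ∃ e : ℤ, d = e ^ 2) :
    {q : ℤ × ℤ | q.1 ^ 2 - d * q.2 ^ 2 = 1}.Infinite := by
  obtain ⟨a, ha⟩ := Pell.IsFundamental.exists_of_not_isSquare hd
    (fun h => hsq ((isSquare_iff_exists_sq d).mp h))
  refine Set.infinite_of_injective_forall_mem (f := fun n : ℤ => ((a ^ n).x, (a ^ n).y)) ?_
    fun n => (a ^ n).prop
  intro m n h
  exact ha.y_strictMono.injective (congrArg Prod.snd h)

/-- A subgroup with a coset contained in the solution set of Pell's equation is trivial. -/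
theorem eq_zero_of_coset_subset_pell_solutions {d : ℤ} (hsq : ¬ ∃ e : ℤ, d = e ^ 2)
    {g : ℤ × ℤ} {H : AddSubgroup (ℤ × ℤ)}
    (hsub : (fun x => g + x) '' (H : Set (ℤ × ℤ)) ⊆ {q : ℤ × ℤ | q.1 ^ 2 - d * q.2 ^ 2 = 1})
    {h : ℤ × ℤ} (hh : h ∈ H) : h = 0 := by
  have h₀ := hsub ⟨0, H.zero_mem, rfl⟩
  have h₁ := hsub ⟨h, hh, rfl⟩
  have h₂ := hsub ⟨-h, H.neg_mem hh, rfl⟩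
  simp only [Set.mem_ofPred_eq, Prod.fst_add, Prod.snd_add, Prod.fst_neg, Prod.snd_neg,
    Prod.fst_zero, Prod.snd_zero] at h₀ h₁ h₂
  have hzero : h.1 ^ 2 - d * h.2 ^ 2 = 0 := by linarith
  obtain ⟨hx, hy⟩ := eq_zero_of_sq_sub_mul_sq_eq_zero hsq hzero
  exact Prod.ext hx hy

/-- Vojta's Pell equation example: for d a positive non-square integer, the solution
set of x² − d·y² = 1 is infinite but is not a finite union of cosets of subgroups
of ℤ × ℤ. -/
theorem pell_solutions_not_finite_union_of_cosets
    (d : ℤ) (hd : 0 < d) (hsq : ¬ ∃ e : ℤ, d = e ^ 2)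
    (S : Set (ℤ × ℤ)) (hS : S = {q : ℤ × ℤ | q.1 ^ 2 - d * q.2 ^ 2 = 1}) :
    S.Infinite ∧
      ¬ ∃ (k : ℕ) (g : Fin k → ℤ × ℤ) (H : Fin k → AddSubgroup (ℤ × ℤ)),
        S = ⋃ i : Fin k, (fun x => g i + x) '' (H i : Set (ℤ × ℤ)) := by
  subst hS
  have hinf := pell_solutions_infinite hd hsq
  refine ⟨hinf, ?_⟩
  rintro ⟨k, g, H, hunion⟩
  apply hinf
  have hsub (i : Fin k) := hunion ▸ Set.subset_iUnion
    (fun i : Fin k => (fun x => g i + x) '' (H i : Set (ℤ × ℤ))) i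
  rw [hunion]
  refine Set.finite_iUnion fun i => ((Set.finite_singleton 0).subset fun h hh => ?_).image _
  exact eq_zero_of_coset_subset_pell_solutions hsq (hsub i) hh
end

section
/- Let d be a positive integer that is not a perfect square, and let a, c, v₁, v₂ be integers. If (a + n·v₁)² − d·(c + n·v₂)² = 1 for every integer n, then v₁ = 0 and v₂ = 0. (That is, the Pell conic x² − d·y² = 1 contains no infinite arithmetic-progression line; this is the computational heart of the Pell-equation counterexample to Mordell–Lang for 𝔾ₐ².) -/
/-- A nonsquare integer `d` admits no nontrivial integer solution of `x ^ 2 = d * y ^ 2`. -/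
theorem eq_zero_of_sq_eq_nonsquare_mul_sq {d x y : ℤ} (hsq : ¬ ∃ e : ℤ, d = e ^ 2)
    (hxy : x ^ 2 = d * y ^ 2) : x = 0 ∧ y = 0 := by
  have hy : y = 0 := by
    by_contra hy
    obtain ⟨k, rfl⟩ : y ∣ x :=
      (Int.pow_dvd_pow_iff two_ne_zero).1 (hxy ▸ dvd_mul_left (y ^ 2) d)
    exact hsq ⟨k, mul_right_cancel₀ (pow_ne_zero 2 hy) (by linarith [mul_pow y k 2])⟩
  subst hy
  exact ⟨by simpa using hxy, rfl⟩

/-- The Pell conic x² − d·y² = 1 (d a positive non-square) contains no infinite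
arithmetic-progression line. -/
theorem pell_no_progression
    (d : ℤ) (hd : 0 < d) (hsq : ¬ ∃ e : ℤ, d = e ^ 2)
    (a c v₁ v₂ : ℤ)
    (h : ∀ n : ℤ, (a + n * v₁) ^ 2 - d * (c + n * v₂) ^ 2 = 1) :
    v₁ = 0 ∧ v₂ = 0 := by
  refine eq_zero_of_sq_eq_nonsquare_mul_sq hsq ?_
  linarith [h 0, h 1, h (-1)]
end

section
/- Consider the commutative group G = ℚ × ℚˣ, whose group operation is addition in the first coordinate and multiplication in the second coordinate (the group of points of 𝔾ₐ × 𝔾ₘ over ℚ). Let Δ = {(x, u) ∈ ℚ × ℚˣ : the rational number underlying u equals x} be the diagonal set. Then Δ is NOT a coset of any subgroup of G, i.e., there is no g ∈ G and subgroup H ≤ G with Δ = g · H. (This is part of the paper's Example 1.2, showing the Mordell–Lang conclusion fails for 𝔾ₐ × 𝔾ₘ.) -/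
/-- A left coset in a commutative group is closed under `(a, b, c) ↦ a * b⁻¹ * c`. -/
theorem Subgroup.mul_inv_mul_mem_image_mul_left {G : Type*} [CommGroup G] (H : Subgroup G)
    {g a b c : G} (ha : a ∈ (fun x => g * x) '' (H : Set G))
    (hb : b ∈ (fun x => g * x) '' (H : Set G)) (hc : c ∈ (fun x => g * x) '' (H : Set G)) :
    a * b⁻¹ * c ∈ (fun x => g * x) '' (H : Set G) := by
  obtain ⟨x, hx, rfl⟩ := ha
  obtain ⟨y, hy, rfl⟩ := hb
  obtain ⟨z, hz, rfl⟩ := hc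
  refine ⟨x * y⁻¹ * z, H.mul_mem (H.mul_mem hx (H.inv_mem hy)) hz, ?_⟩
  dsimp only
  rw [mul_inv, mul_mul_mul_comm g x, mul_inv_cancel, one_mul, mul_left_comm]

/-- Example 1.2 (part): in G = ℚ × ℚˣ (addition in the first coordinate,
multiplication in the second), the diagonal Δ is not a coset of any subgroup. -/
theorem diagonal_not_coset
    (Δ : Set (Multiplicative ℚ × ℚˣ))
    (hΔ : Δ = {p : Multiplicative ℚ × ℚˣ | ((p.2 : ℚ)) = Multiplicative.toAdd p.1}) :
    ¬ ∃ (g : Multiplicative ℚ × ℚˣ) (H : Subgroup (Multiplicative ℚ × ℚˣ)),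
      Δ = (fun x => g * x) '' (H : Set (Multiplicative ℚ × ℚˣ)) := by
  rintro ⟨g, H, h⟩
  have h_one : (Multiplicative.ofAdd (1 : ℚ), (1 : ℚˣ)) ∈ Δ := by simp [hΔ]
  have h_neg : (Multiplicative.ofAdd (-1 : ℚ), (-1 : ℚˣ)) ∈ Δ := by simp [hΔ]
  have h_mem := H.mul_inv_mul_mem_image_mul_left (h ▸ h_one) (h ▸ h_neg) (h ▸ h_one)
  rw [← h, hΔ] at h_mem
  norm_num at h_mem
end

section
/- Consider the commutative group G = ℚ × ℚˣ, whose group operation is addition in the first coordinate and multiplication in the second coordinate. Let Γ ≤ G be the subgroup generated by (1, 1) and (0, 2), and let Δ = {(x, u) ∈ ℚ × ℚˣ : the rational number underlying u equals x}. Then Δ ∩ Γ = {(2ⁿ, 2ⁿ) : n ∈ ℕ}, i.e., the intersection of the diagonal with Γ consists exactly of the points (2ⁿ, 2ⁿ) for natural numbers n. (Exact computation of the intersection in the paper's Example 1.2.) -/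
theorem exists_nat_eq_of_two_zpow_eq_intCast {a b : ℤ} (h : (2 : ℚ) ^ b = a) :
    ∃ n : ℕ, b = n := by
  obtain ⟨n, rfl | rfl⟩ := b.eq_nat_or_neg
  · exact ⟨n, rfl⟩
  · have h1 : (1 : ℚ) = a * 2 ^ n := by
      rw [← h, zpow_neg, zpow_natCast, inv_mul_cancel₀ (by positivity)]
    have h2 : (1 : ℤ) = a * 2 ^ n := by exact_mod_cast h1
    rcases n with _ | n
    · exact ⟨0, by simp⟩
    · rw [pow_succ, ← mul_assoc] at h2
      omega

/-- Example 1.2 (exact intersection): in G = ℚ × ℚˣ, with Γ the subgroup generated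
by (1,1) and (0,2) and Δ the diagonal, Δ ∩ Γ = {(2ⁿ, 2ⁿ) : n ∈ ℕ}. -/
theorem diagonal_inter_gamma_eq
    (Δ : Set (Multiplicative ℚ × ℚˣ))
    (hΔ : Δ = {p : Multiplicative ℚ × ℚˣ | ((p.2 : ℚ)) = Multiplicative.toAdd p.1})
    (Γ : Subgroup (Multiplicative ℚ × ℚˣ))
    (hΓ : Γ = Subgroup.closure
      {(Multiplicative.ofAdd (1 : ℚ), (1 : ℚˣ)),
       (Multiplicative.ofAdd (0 : ℚ), Units.mk0 (2 : ℚ) (by norm_num))}) :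
    Δ ∩ (Γ : Set (Multiplicative ℚ × ℚˣ)) =
      {p : Multiplicative ℚ × ℚˣ | ∃ n : ℕ,
        p = (Multiplicative.ofAdd ((2 : ℚ) ^ n),
             (Units.mk0 (2 : ℚ) (by norm_num)) ^ n)} := by
  subst hΔ hΓ
  ext ⟨x, u⟩
  simp only [Set.mem_inter_iff, Set.mem_ofPred_eq, SetLike.mem_coe, Subgroup.mem_closure_pair]
  constructor
  · rintro ⟨hd, a, b, hab⟩
    obtain ⟨rfl, rfl⟩ := Prod.ext_iff.mp hab
    have h : (2 : ℚ) ^ b = a := by simpa using hd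
    obtain ⟨n, rfl⟩ := exists_nat_eq_of_two_zpow_eq_intCast h
    refine ⟨n, Prod.ext ?_ (by simp)⟩
    apply Multiplicative.toAdd.injective
    simpa using h.symm
  · rintro ⟨n, hn⟩
    obtain ⟨rfl, rfl⟩ := Prod.ext_iff.mp hn
    refine ⟨by simp, 2 ^ n, n, Prod.ext ?_ (by simp)⟩
    apply Multiplicative.toAdd.injective
    simp
end

section
/- The set S = {(2ⁿ, n) : n ∈ ℕ}, viewed as a subset of the additive group ℤ × ℤ, is infinite but is NOT equal to any finite union of cosets of subgroups of ℤ × ℤ. (Under the isomorphism of the subgroup Γ generated by (1,1) and (0,2) in ℚ × ℚˣ with ℤ × ℤ, this shows that the intersection of the diagonal of 𝔾ₐ × 𝔾ₘ with Γ is not a finite union of cosets of subgroups of Γ, completing the paper's Example 1.2.) -/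
/-- A coset in `ℤ × ℤ` whose second coordinates are nonnegative lies on a horizontal line. -/
theorem AddSubgroup.snd_eq_zero_of_coset_snd_nonneg {H : AddSubgroup (ℤ × ℤ)} {g : ℤ × ℤ}
    (hg : ∀ x ∈ H, 0 ≤ (g + x).2) {x : ℤ × ℤ} (hx : x ∈ H) : x.2 = 0 := by
  by_contra hne
  have h0 : 0 ≤ g.2 := by simpa using hg 0 H.zero_mem
  have h1 := hg _ (H.zsmul_mem hx (-(g.2 + 1) * x.2))
  simp only [Prod.snd_add, Prod.smul_snd, smul_eq_mul] at h1
  have h2 : 0 < x.2 * x.2 := mul_self_pos.mpr hne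
  nlinarith

/-- A coset contained in the graph `{(f n, n) : n ∈ ℕ}` has at most one element. -/
theorem AddSubgroup.coset_subsingleton_of_subset_nat_graph (f : ℕ → ℤ)
    {H : AddSubgroup (ℤ × ℤ)} {g : ℤ × ℤ}
    (hg : ∀ x ∈ H, ∃ n : ℕ, g + x = (f n, (n : ℤ))) :
    ((fun x => g + x) '' (H : Set (ℤ × ℤ))).Subsingleton := by
  have hsnd : ∀ x ∈ H, x.2 = 0 := fun x hx =>
    snd_eq_zero_of_coset_snd_nonneg (g := g) (fun y hy => by
      obtain ⟨n, hn⟩ := hg y hy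
      simp [hn]) hx
  rintro _ ⟨x, hx, rfl⟩ _ ⟨y, hy, rfl⟩
  obtain ⟨m, hm⟩ := hg x hx
  obtain ⟨n, hn⟩ := hg y hy
  have h1 := congrArg Prod.snd hm
  have h2 := congrArg Prod.snd hn
  simp only [Prod.snd_add, hsnd x hx, hsnd y hy] at h1 h2
  have hmn : m = n := by omega
  simp only [hm, hn, hmn]

/-- Example 1.2 (conclusion): the set {(2ⁿ, n) : n ∈ ℕ} ⊆ ℤ × ℤ is infinite but is
not a finite union of cosets of subgroups of ℤ × ℤ. -/
theorem exponential_set_not_finite_union_of_cosets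
    (S : Set (ℤ × ℤ)) (hS : S = {q : ℤ × ℤ | ∃ n : ℕ, q = ((2 ^ n : ℤ), (n : ℤ))}) :
    S.Infinite ∧
      ¬ ∃ (k : ℕ) (g : Fin k → ℤ × ℤ) (H : Fin k → AddSubgroup (ℤ × ℤ)),
        S = ⋃ i : Fin k, (fun x => g i + x) '' (H i : Set (ℤ × ℤ)) := by
  have hinf : S.Infinite := by
    have hinj : Function.Injective fun n : ℕ => ((2 ^ n : ℤ), (n : ℤ)) := fun m n h =>
      Int.ofNat_inj.mp (congrArg Prod.snd h)
    refine (Set.infinite_range_of_injective hinj).mono ?_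
    rintro _ ⟨n, rfl⟩
    rw [hS]
    exact ⟨n, rfl⟩
  refine ⟨hinf, ?_⟩
  rintro ⟨k, g, H, h⟩
  refine hinf (h ▸ Set.finite_iUnion fun i => Set.Subsingleton.finite ?_)
  refine AddSubgroup.coset_subsingleton_of_subset_nat_graph (fun n => 2 ^ n) fun x hx => ?_
  have hmem : g i + x ∈ S := h ▸ Set.mem_iUnion.mpr ⟨i, x, hx, rfl⟩
  rw [hS] at hmem
  exact hmem
end
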